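/- Let A ∈ ℝ^{m×n} have rank r. If ‖E_j‖₂ < ε for all j = 2,…,k and M̃ = [A, A+E₂, …, A+E_k], then for each i with r < i ≤ min(m,kn), σ_i(M̃) ≤ √((k−1)ε(2‖A‖₂ + ε)); in particular σ_i(M̃) → 0 as ε → 0. -/

import Mathlib

open Matrix Finset

/-- Spectral (ℓ²-operator) norm of a matrix. -/
noncomputable def specNorm {m n : Type*} [Fintype m] [Fintype n] [DecidableEq n]
    (A : Matrix m n ℝ) : ℝ :=
  ‖LinearMap.toContinuousLinearMap (Matrix.toEuclideanLin A)‖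

/-- Eigenvalues of a real symmetric matrix, in nonincreasing order (0-based);
returns 0 if the matrix is not Hermitian. -/
noncomputable def eigDesc {n : ℕ} (A : Matrix (Fin n) (Fin n) ℝ) : Fin n → ℝ :=
  if hA : A.IsHermitian then
    fun i => hA.eigenvalues (Tuple.sort hA.eigenvalues i.rev)
  else fun _ => 0

/-- The `i`-th largest singular value (0-based), defined as the square root of the
`i`-th largest eigenvalue of `Aᵀ * A`; zero for out-of-range indices. -/
noncomputable def sval {m n : ℕ} (A : Matrix (Fin m) (Fin n) ℝ) (i : ℕ) : ℝ :=
  if h : i < n then Real.sqrt (eigDesc (Aᵀ * A) ⟨i, h⟩) else 0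

/-- Horizontal concatenation of `k` matrices of size `m × n`. -/
noncomputable def hconcat {m n k : ℕ} (A : Fin k → Matrix (Fin m) (Fin n) ℝ) :
    Matrix (Fin m) (Fin (k * n)) ℝ :=
  Matrix.of fun i j => A (finProdFinEquiv.symm j).1 i (finProdFinEquiv.symm j).2

/-- If `N` differs from a matrix of rank at most `i` by a matrix of squared operator norm at
most `c`, then its singular values from index `i` on are at most `√c`. -/
theorem sval_le_sqrt_of_rank_le {m n : ℕ} (N B : Matrix (Fin m) (Fin n) ℝ) (i : ℕ) (c : ℝ)
    (hB : B.rank ≤ i)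
    (hc : ∀ v, ‖Matrix.toEuclideanLin (N - B) v‖ ^ 2 ≤ c * ‖v‖ ^ 2) :
    sval N i ≤ Real.sqrt c := by
  unfold sval
  split_ifs with hin
  swap
  · exact Real.sqrt_nonneg _
  apply Real.sqrt_le_sqrt
  have hH : (Nᵀ * N).IsHermitian := by
    simpa using Matrix.isHermitian_conjTranspose_mul_self N
  rw [eigDesc, dif_pos hH]
  set e : Fin (i + 1) → Fin n :=
    fun j => Tuple.sort hH.eigenvalues (Fin.castLE hin j).rev with he
  have he_inj : Function.Injective e := fun a b hab =>
    Fin.castLE_injective _ (Fin.rev_injective ((Tuple.sort hH.eigenvalues).injective hab))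
  set l := hH.eigenvalues (Tuple.sort hH.eigenvalues (Fin.rev ⟨i, hin⟩)) with hl
  have hle : ∀ j, l ≤ hH.eigenvalues (e j) := fun j => by
    refine Tuple.monotone_sort hH.eigenvalues (Fin.rev_le_rev.2 ?_)
    exact Fin.mk_le_mk.2 (Nat.lt_succ_iff.1 j.2)
  set u : Fin (i + 1) → EuclideanSpace ℝ (Fin n) := fun j => hH.eigenvectorBasis (e j) with hu
  have hu_orth : Orthonormal ℝ u := hH.eigenvectorBasis.orthonormal.comp e he_inj
  have hu_eig : ∀ j, Matrix.toEuclideanLin (Nᵀ * N) (u j) = hH.eigenvalues (e j) • u j := by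
    intro j
    apply (WithLp.ofLp_injective 2)
    simpa [Matrix.toLpLin_apply] using hH.mulVec_eigenvectorBasis (e j)
  -- a nonzero combination of the top `i + 1` eigenvectors is killed by `B`
  obtain ⟨a, ha, ha0⟩ : ∃ a : Fin (i + 1) → ℝ,
      Matrix.toEuclideanLin B (∑ j, a j • u j) = 0 ∧ a ≠ 0 := by
    let f := (Matrix.toEuclideanLin B).rangeRestrict ∘ₗ Fintype.linearCombination ℝ u
    have hf : LinearMap.ker f ≠ ⊥ := by
      apply LinearMap.ker_ne_bot_of_finrank_lt
      rw [Matrix.toEuclideanLin, Matrix.toLpLin_eq_toLin,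
        ← Matrix.rank_eq_finrank_range_toLin B (PiLp.basisFun 2 ℝ _) (PiLp.basisFun 2 ℝ _)]
      simpa using Nat.lt_succ_of_le hB
    obtain ⟨a, ha, ha0⟩ := (Submodule.ne_bot_iff _).1 hf
    refine ⟨a, ?_, ha0⟩
    simpa [f, Fintype.linearCombination_apply] using congrArg Subtype.val (LinearMap.mem_ker.1 ha)
  set v := ∑ j, a j • u j with hv
  have hv2 : ‖v‖ ^ 2 = ∑ j, a j * a j := by
    rw [← real_inner_self_eq_norm_sq, hv, hu_orth.inner_sum]
    simp
  have hNv : ‖Matrix.toEuclideanLin N v‖ ^ 2 = ∑ j, hH.eigenvalues (e j) * (a j * a j) := by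
    have h1 : ‖Matrix.toEuclideanLin N v‖ ^ 2
        = inner ℝ v (Matrix.toEuclideanLin (Nᵀ * N) v) := by
      rw [← real_inner_self_eq_norm_sq, ← LinearMap.adjoint_inner_right,
        ← Matrix.toEuclideanLin_conjTranspose_eq_adjoint]
      congr 1
      apply (WithLp.ofLp_injective 2)
      simp [Matrix.toLpLin_apply]
    have h2 : Matrix.toEuclideanLin (Nᵀ * N) v
        = ∑ j, (hH.eigenvalues (e j) * a j) • u j := by
      rw [hv, map_sum]
      refine Finset.sum_congr rfl fun j _ => ?_
      rw [map_smul, hu_eig, smul_smul, mul_comm]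
    rw [h1, h2, hv, hu_orth.inner_sum]
    refine Finset.sum_congr rfl fun j _ => ?_
    simp
    ring
  have hpos : 0 < ‖v‖ ^ 2 := by
    obtain ⟨j, hj⟩ := Function.ne_iff.1 ha0
    rw [hv2]
    exact Finset.sum_pos' (fun _ _ => mul_self_nonneg _)
      ⟨j, Finset.mem_univ _, mul_self_pos.2 hj⟩
  have hlow : l * ‖v‖ ^ 2 ≤ ‖Matrix.toEuclideanLin N v‖ ^ 2 := by
    rw [hv2, hNv, Finset.mul_sum]
    exact Finset.sum_le_sum fun j _ => mul_le_mul_of_nonneg_right (hle j) (mul_self_nonneg _)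
  have hup := hc v
  rw [map_sub, LinearMap.sub_apply, ha, sub_zero] at hup
  exact le_of_mul_le_mul_right (hlow.trans hup) hpos

theorem specNorm_nonneg {m n : ℕ} (A : Matrix (Fin m) (Fin n) ℝ) : 0 ≤ specNorm A :=
  norm_nonneg _

theorem norm_toEuclideanLin_le_specNorm {m n : ℕ} (A : Matrix (Fin m) (Fin n) ℝ)
    (v : EuclideanSpace ℝ (Fin n)) :
    ‖Matrix.toEuclideanLin A v‖ ≤ specNorm A * ‖v‖ :=
  (LinearMap.toContinuousLinearMap (Matrix.toEuclideanLin A)).le_opNorm v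

theorem sval_nonneg {m n : ℕ} (A : Matrix (Fin m) (Fin n) ℝ) (i : ℕ) : 0 ≤ sval A i := by
  unfold sval
  split_ifs
  exacts [Real.sqrt_nonneg _, le_rfl]

theorem rank_hconcat_const_le {m n k : ℕ} (A : Matrix (Fin m) (Fin n) ℝ) :
    (hconcat fun _ : Fin k => A).rank ≤ A.rank := by
  have h : (hconcat fun _ : Fin k => A) =
      A * hconcat fun _ : Fin k => (1 : Matrix (Fin n) (Fin n) ℝ) := by
    ext i j
    simp [hconcat, Matrix.mul_apply, Matrix.one_apply]
  rw [h]
  exact Matrix.rank_mul_le_left _ _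

/-- The `j`-th block of a vector of length `k * n`. -/
def vecBlock {k n : ℕ} (v : EuclideanSpace ℝ (Fin (k * n))) (j : Fin k) :
    EuclideanSpace ℝ (Fin n) :=
  WithLp.toLp 2 fun a => v (finProdFinEquiv (j, a))

theorem sum_norm_sq_vecBlock {k n : ℕ} (v : EuclideanSpace ℝ (Fin (k * n))) :
    ∑ j, ‖vecBlock v j‖ ^ 2 = ‖v‖ ^ 2 := by
  simp only [EuclideanSpace.norm_sq_eq, vecBlock]
  rw [← Equiv.sum_comp finProdFinEquiv, Fintype.sum_prod_type]

theorem toEuclideanLin_hconcat {m n k : ℕ} (F : Fin k → Matrix (Fin m) (Fin n) ℝ)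
    (v : EuclideanSpace ℝ (Fin (k * n))) :
    Matrix.toEuclideanLin (hconcat F) v = ∑ j, Matrix.toEuclideanLin (F j) (vecBlock v j) := by
  ext i
  simp only [Matrix.toLpLin_apply, Matrix.mulVec, dotProduct, hconcat, vecBlock,
    Matrix.of_apply, WithLp.ofLp_sum, Finset.sum_apply]
  rw [← Equiv.sum_comp finProdFinEquiv, Fintype.sum_prod_type]
  simp

/-- A concatenation of `k` blocks, one of them zero and all of norm at most `ε`, has squared
operator norm at most `(k - 1) * ε ^ 2`. -/
theorem norm_sq_toEuclideanLin_hconcat_le {m n k : ℕ} (F : Fin k → Matrix (Fin m) (Fin n) ℝ)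
    (j₀ : Fin k) (hF0 : F j₀ = 0) {ε : ℝ} (hF : ∀ j, specNorm (F j) ≤ ε)
    (v : EuclideanSpace ℝ (Fin (k * n))) :
    ‖Matrix.toEuclideanLin (hconcat F) v‖ ^ 2 ≤ ((k - 1) * ε ^ 2) * ‖v‖ ^ 2 := by
  have hcard : ((Finset.univ.erase j₀).card : ℝ) = k - 1 := by
    rw [Finset.cast_card_erase_of_mem (Finset.mem_univ _), Finset.card_univ, Fintype.card_fin]
  have h1 : ‖Matrix.toEuclideanLin (hconcat F) v‖
      ≤ ε * ∑ j ∈ Finset.univ.erase j₀, ‖vecBlock v j‖ := by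
    rw [toEuclideanLin_hconcat, ← Finset.add_sum_erase _ _ (Finset.mem_univ j₀), hF0, map_zero,
      LinearMap.zero_apply, zero_add, Finset.mul_sum]
    exact norm_sum_le_of_le _ fun j _ => (norm_toEuclideanLin_le_specNorm _ _).trans
      (mul_le_mul_of_nonneg_right (hF j) (norm_nonneg _))
  have h2 : (∑ j ∈ Finset.univ.erase j₀, ‖vecBlock v j‖) ^ 2 ≤ (k - 1) * ‖v‖ ^ 2 := by
    refine sq_sum_le_card_mul_sum_sq.trans ?_
    rw [hcard, ← sum_norm_sq_vecBlock v]
    refine mul_le_mul_of_nonneg_left ?_ (hcard ▸ Nat.cast_nonneg _)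
    exact Finset.sum_le_sum_of_subset_of_nonneg (Finset.erase_subset _ _)
      fun _ _ _ => sq_nonneg _
  calc _ ≤ (ε * ∑ j ∈ Finset.univ.erase j₀, ‖vecBlock v j‖) ^ 2 :=
        pow_le_pow_left₀ (norm_nonneg _) h1 2
    _ = ε ^ 2 * (∑ j ∈ Finset.univ.erase j₀, ‖vecBlock v j‖) ^ 2 := mul_pow _ _ _
    _ ≤ ε ^ 2 * ((k - 1) * ‖v‖ ^ 2) := mul_le_mul_of_nonneg_left h2 (sq_nonneg _)
    _ = _ := by ring

theorem stmt13 {m n k : ℕ} (hk : 2 ≤ k) (A : Matrix (Fin m) (Fin n) ℝ)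
    (E : ℝ → Fin k → Matrix (Fin m) (Fin n) ℝ)
    (hE0 : ∀ ε, E ε ⟨0, by omega⟩ = 0)
    (hE : ∀ ε > 0, ∀ j : Fin k, specNorm (E ε j) < ε)
    (i : ℕ) (hi : A.rank ≤ i) (hi2 : i < min m (k * n)) :
    (∀ ε > 0,
      sval (hconcat fun j => A + E ε j) i
        ≤ Real.sqrt ((k - 1) * ε * (2 * specNorm A + ε))) ∧
    Filter.Tendsto (fun ε => sval (hconcat fun j => A + E ε j) i)
      (nhdsWithin 0 (Set.Ioi 0)) (nhds 0) := by
  have hbound : ∀ ε > 0, sval (hconcat fun j => A + E ε j) i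
      ≤ Real.sqrt ((k - 1) * ε * (2 * specNorm A + ε)) := by
    intro ε hε
    have hsub : (hconcat fun j => A + E ε j) - (hconcat fun _ => A) = hconcat (E ε) := by
      ext a b
      simp [hconcat]
    refine (sval_le_sqrt_of_rank_le _ (hconcat fun _ => A) i ((k - 1) * ε ^ 2)
      ((rank_hconcat_const_le A).trans hi) ?_).trans (Real.sqrt_le_sqrt ?_)
    · rw [hsub]
      exact norm_sq_toEuclideanLin_hconcat_le _ _ (hE0 ε) fun j => (hE ε hε j).le
    · have hk1 : (0 : ℝ) ≤ k - 1 := by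
        have : (2 : ℝ) ≤ k := by exact_mod_cast hk
        linarith
      have : 0 ≤ (k - 1) * ε * specNorm A :=
        mul_nonneg (mul_nonneg hk1 hε.le) (specNorm_nonneg A)
      linarith
  refine ⟨hbound, ?_⟩
  have hlim : Filter.Tendsto (fun ε : ℝ => Real.sqrt ((k - 1) * ε * (2 * specNorm A + ε)))
      (nhdsWithin 0 (Set.Ioi 0)) (nhds 0) := by
    have hcont : Continuous fun ε : ℝ => Real.sqrt ((k - 1) * ε * (2 * specNorm A + ε)) := by
      fun_prop
    simpa using (hcont.tendsto 0).mono_left nhdsWithin_le_nhds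
  exact squeeze_zero' (Filter.Eventually.of_forall fun ε => sval_nonneg _ _)
    (Filter.eventually_of_mem self_mem_nhdsWithin hbound) hlim
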